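/- Let w ∈ S_N be 45231- and 45132-avoiding. If some N-occurrence {a, N, b, c} of the pattern 3412 in w (with a, b, c the letters playing the roles of 3, 1, 2 respectively) is such that there exists no k ∈ newrep(w) with (a,c) = (M_k, m_k), then w has an N-occurrence of at least one of the patterns 43512, 34512, and 35412. -/

import Mathlib

/-!
Common framework.  Permutations of `{1, …, m}` are modelled as `Equiv.Perm (Fin m)`
with 0-based positions and values.  The simple reflection `sr m i` (for
`0 ≤ i ≤ m - 2`, corresponding to the paper's `s_{i+1}`) swaps the values `i` and
`i + 1`.  Cut statistics `Mstat w k` / `mstat w k` (the paper's `M_{k+1}`/`m_{k+1}`)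
are respectively the maximum of the first `k + 1` entries and the minimum of the
remaining entries of the one-line notation of `w`.
-/

/-- The simple reflection swapping `i` and `i + 1` (0-based) in the symmetric group
on `Fin m`; the identity if out of range. -/
def sr (m i : ℕ) : Equiv.Perm (Fin m) :=
  if h : i + 1 < m then Equiv.swap ⟨i, Nat.lt_of_succ_lt h⟩ ⟨i + 1, h⟩ else 1

/-- `l` is a word in the simple reflections whose product is `w`. -/
def IsWord (m : ℕ) (l : List ℕ) (w : Equiv.Perm (Fin m)) : Prop :=
  (∀ i ∈ l, i + 1 < m) ∧ (l.map (sr m)).prod = w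

/-- The Coxeter length `ℓ(w)`: the minimal length of a word expressing `w`. -/
noncomputable def len {m : ℕ} (w : Equiv.Perm (Fin m)) : ℕ :=
  sInf {c | ∃ l : List ℕ, IsWord m l w ∧ l.length = c}

/-- `l` is a reduced decomposition of `w`. -/
def IsReducedWord {m : ℕ} (w : Equiv.Perm (Fin m)) (l : List ℕ) : Prop :=
  IsWord m l w ∧ l.length = len w

/-- The support of `w`: the letters appearing in some reduced decomposition. -/
noncomputable def supp {m : ℕ} (w : Equiv.Perm (Fin m)) : Set ℕ :=
  {i | ∃ l : List ℕ, IsReducedWord w l ∧ i ∈ l}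

/-- `rep w = ℓ(w) - |supp w|`, the number of repeated letters. -/
noncomputable def rep {m : ℕ} (w : Equiv.Perm (Fin m)) : ℕ :=
  len w - (supp w).ncard

/-- The value of `w` at the (0-based) position `i`, as a natural number. -/
def valAt {m : ℕ} (w : Equiv.Perm (Fin m)) (i : ℕ) : ℕ :=
  if h : i < m then (w ⟨i, h⟩ : ℕ) else 0

/-- The (0-based) position at which the value `v` occurs in `w`. -/
def posOf {m : ℕ} (w : Equiv.Perm (Fin m)) (v : ℕ) : ℕ :=
  if h : v < m then (w⁻¹ ⟨v, h⟩ : ℕ) else 0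

/-- `Mstat w k`: the maximum of the first `k + 1` entries of `w`. -/
noncomputable def Mstat {m : ℕ} (w : Equiv.Perm (Fin m)) (k : ℕ) : ℕ :=
  sSup {v | ∃ i : Fin m, (i : ℕ) ≤ k ∧ (w i : ℕ) = v}

/-- `mstat w k`: the minimum of the entries of `w` in positions `> k`. -/
noncomputable def mstat {m : ℕ} (w : Equiv.Perm (Fin m)) (k : ℕ) : ℕ :=
  sInf {v | ∃ i : Fin m, k < (i : ℕ) ∧ (w i : ℕ) = v}

/-- `wbar` is obtained from `w` by deleting the largest letter from the one-line
notation of `w` and sliding all subsequent letters one space to the left. -/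
def IsDeletion {n : ℕ} (w : Equiv.Perm (Fin (n + 1))) (wbar : Equiv.Perm (Fin n)) : Prop :=
  ∀ i : Fin n, (wbar i : ℕ) =
    if (i : ℕ) < posOf w n then valAt w (i : ℕ) else valAt w ((i : ℕ) + 1)

/-- `newrep w wbar`: the letters `k` with `s_k ∈ supp(wbar)` and `w⁻¹(top) ≤ k`. -/
noncomputable def newrep {n : ℕ} (w : Equiv.Perm (Fin (n + 1))) (wbar : Equiv.Perm (Fin n)) :
    Set ℕ :=
  {k | k ∈ supp wbar ∧ posOf w n ≤ k}

/-- An occurrence of the pattern `p` in `w`, recorded by its set `S` of values: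
there are positions `f 0 < f 1 < ⋯` whose values are in the same relative order
as `p`, and `S` is the corresponding set of values. -/
def IsOccSet {m c : ℕ} (p : Fin c → ℕ) (w : Equiv.Perm (Fin m)) (S : Finset ℕ) : Prop :=
  ∃ f : Fin c → Fin m, StrictMono f ∧ (∀ a b : Fin c, p a < p b ↔ w (f a) < w (f b)) ∧
    S = Finset.image (fun a => (w (f a) : ℕ)) Finset.univ

/-- An `N`-occurrence (here `N = n`, the largest 0-based value): an occurrence
whose largest letter is the largest value of `w`. -/
def IsTopOccSet {n c : ℕ} (p : Fin c → ℕ) (w : Equiv.Perm (Fin (n + 1))) (S : Finset ℕ) : Prop :=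
  IsOccSet p w S ∧ n ∈ S

/-- The number of occurrences of the pattern `p` in `w`. -/
noncomputable def occCount {m c : ℕ} (p : Fin c → ℕ) (w : Equiv.Perm (Fin m)) : ℕ :=
  Set.ncard {S : Finset ℕ | IsOccSet p w S}

/-- The number of `N`-occurrences of the pattern `p` in `w`. -/
noncomputable def topOccCount {n c : ℕ} (p : Fin c → ℕ) (w : Equiv.Perm (Fin (n + 1))) : ℕ :=
  Set.ncard {S : Finset ℕ | IsTopOccSet p w S}

def p321 : Fin 3 → ℕ := ![3, 2, 1]
def p3412 : Fin 4 → ℕ := ![3, 4, 1, 2]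
def p4321 : Fin 4 → ℕ := ![4, 3, 2, 1]
def p34512 : Fin 5 → ℕ := ![3, 4, 5, 1, 2]
def p45123 : Fin 5 → ℕ := ![4, 5, 1, 2, 3]
def p35412 : Fin 5 → ℕ := ![3, 5, 4, 1, 2]
def p43512 : Fin 5 → ℕ := ![4, 3, 5, 1, 2]
def p45132 : Fin 5 → ℕ := ![4, 5, 1, 3, 2]
def p45213 : Fin 5 → ℕ := ![4, 5, 2, 1, 3]
def p53412 : Fin 5 → ℕ := ![5, 3, 4, 1, 2]
def p45312 : Fin 5 → ℕ := ![4, 5, 3, 1, 2]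
def p45231 : Fin 5 → ℕ := ![4, 5, 2, 3, 1]

/-- The pattern `𝔭_k(w)` of Definition 4.4, recorded as its set of values:
(I) if `w⁻¹(top)` is left of `w⁻¹(M_k)`, the 321-occurrence `{top, M_k, m_k}`;
(II) else if `wbar(k) > m_k`, the 321-occurrence `{top, wbar(k), m_k}`;
(III) otherwise the 3412-occurrence `{M_k, top, wbar(k), m_k}`. -/
noncomputable def pocc {n : ℕ} (w : Equiv.Perm (Fin (n + 1))) (wbar : Equiv.Perm (Fin n))
    (k : ℕ) : Finset ℕ :=
  if posOf w n < posOf w (Mstat wbar k) then {n, Mstat wbar k, mstat wbar k}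
  else if mstat wbar k < valAt wbar k then {n, valAt wbar k, mstat wbar k}
  else {Mstat wbar k, n, valAt wbar k, mstat wbar k}

theorem posOf_eq_of_apply_eq_last {n : ℕ} {w : Equiv.Perm (Fin (n + 1))} {i : Fin (n + 1)}
    (h : w i = Fin.last n) : posOf w n = i := by
  have h' : w⁻¹ (Fin.last n) = i := by rw [← h]; exact w.symm_apply_apply i
  have : (⟨n, n.lt_succ_self⟩ : Fin (n + 1)) = Fin.last n := rfl
  simp [posOf, this, h']

theorem IsDeletion.exists_eq {n : ℕ} {w : Equiv.Perm (Fin (n + 1))} {wbar : Equiv.Perm (Fin n)}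
    (hdel : IsDeletion w wbar) {p : Fin (n + 1)} (hp : w p = Fin.last n) (j : Fin n) :
    ∃ i : Fin (n + 1), (wbar j : ℕ) = w i ∧
      ((j : ℕ) < p ∧ (i : ℕ) = j ∨ (p : ℕ) ≤ j ∧ (i : ℕ) = j + 1) := by
  have h := hdel j
  rw [posOf_eq_of_apply_eq_last hp] at h
  split_ifs at h with hlt
  · refine ⟨⟨j, by omega⟩, ?_, Or.inl ⟨hlt, rfl⟩⟩
    rw [h, valAt, dif_pos (by omega)]
  · refine ⟨⟨j + 1, by omega⟩, ?_, Or.inr ⟨by omega, rfl⟩⟩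
    rw [h, valAt, dif_pos (by omega)]

theorem exists_isWord {m : ℕ} (w : Equiv.Perm (Fin m)) : ∃ l : List ℕ, IsWord m l w := by
  cases m with
  | zero => exact ⟨[], by simp, Subsingleton.elim _ _⟩
  | succ m =>
    have hw : w ∈ Submonoid.closure
        (Set.range fun i : Fin m => Equiv.swap i.castSucc i.succ) := by
      rw [Equiv.Perm.mclosure_swap_castSucc_succ]; trivial
    induction hw using Submonoid.closure_induction with
    | mem x hx =>
      obtain ⟨i, rfl⟩ := hx
      refine ⟨[i], by simp, ?_⟩
      simp only [List.map_cons, List.map_nil, List.prod_cons, List.prod_nil, mul_one]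
      rw [sr, dif_pos (by omega)]
      rfl
    | one => exact ⟨[], by simp, rfl⟩
    | mul x y _ _ hx hy =>
      obtain ⟨l, hl, rfl⟩ := hx
      obtain ⟨l', hl', rfl⟩ := hy
      refine ⟨l ++ l', fun i hi => ?_, by simp⟩
      rcases List.mem_append.1 hi with hi | hi
      exacts [hl i hi, hl' i hi]

theorem exists_isReducedWord {m : ℕ} (w : Equiv.Perm (Fin m)) :
    ∃ l : List ℕ, IsReducedWord w l := by
  obtain ⟨l, hl⟩ := exists_isWord w
  obtain ⟨l', hl', hlen⟩ :=
    Nat.sInf_mem (s := {c | ∃ l : List ℕ, IsWord m l w ∧ l.length = c}) ⟨_, l, hl, rfl⟩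
  exact ⟨l', hl', hlen⟩

theorem sr_apply_le_iff {m i k : ℕ} (h : i ≠ k) (x : Fin m) :
    (sr m i x : ℕ) ≤ k ↔ (x : ℕ) ≤ k := by
  unfold sr
  split_ifs with hi
  · rw [Equiv.swap_apply_def]
    split_ifs with h1 h2
    · subst h1; simp only; omega
    · subst h2; simp only; omega
    · rfl
  · rfl

theorem prod_sr_apply_le_iff {m k : ℕ} {l : List ℕ} (h : k ∉ l) (x : Fin m) :
    ((l.map (sr m)).prod x : ℕ) ≤ k ↔ (x : ℕ) ≤ k := by
  induction l with
  | nil => simp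
  | cons i l ih =>
    simp only [List.mem_cons, not_or] at h
    rw [List.map_cons, List.prod_cons, Equiv.Perm.mul_apply, sr_apply_le_iff (Ne.symm h.1), ih h.2]

/-- An inversion of `w` straddling the cut after position `k` forces `s_k` into the support. -/
theorem mem_supp_of_inversion {m k : ℕ} {w : Equiv.Perm (Fin m)} {i j : Fin m}
    (hi : (i : ℕ) ≤ k) (hj : k < j) (hij : w j < w i) : k ∈ supp w := by
  obtain ⟨l, hl⟩ := exists_isReducedWord w
  refine ⟨l, hl, ?_⟩
  by_contra hk
  have h := fun x => prod_sr_apply_le_iff (m := m) hk x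
  rw [hl.1.2] at h
  have h1 := (h i).2 hi
  have h2 := mt (h j).1 (by omega)
  omega

theorem Mstat_eq {m k : ℕ} {w : Equiv.Perm (Fin m)} {i : Fin m} (hi : (i : ℕ) ≤ k)
    (h : ∀ j : Fin m, (j : ℕ) ≤ k → w j ≤ w i) : Mstat w k = w i :=
  IsGreatest.csSup_eq ⟨⟨i, hi, rfl⟩, by rintro _ ⟨j, hj, rfl⟩; exact h j hj⟩

theorem mstat_eq {m k : ℕ} {w : Equiv.Perm (Fin m)} {i : Fin m} (hi : k < i)
    (h : ∀ j : Fin m, k < j → w i ≤ w j) : mstat w k = w i :=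
  IsLeast.csInf_eq ⟨⟨i, hi, rfl⟩, by rintro _ ⟨j, hj, rfl⟩; exact h j hj⟩

theorem isOccSet_of_strictMono {m c : ℕ} {p : Fin c → ℕ} {w : Equiv.Perm (Fin m)}
    {f : Fin c → Fin m} (hf : StrictMono f) (hp : Function.Injective p)
    (h : ∀ a b, p a < p b → w (f a) < w (f b)) :
    IsOccSet p w (Finset.image (fun a => (w (f a) : ℕ)) Finset.univ) := by
  refine ⟨f, hf, fun a b => ⟨h a b, fun hab => ?_⟩, rfl⟩
  rcases lt_trichotomy (p a) (p b) with hlt | heq | hgt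
  · exact hlt
  · exact absurd hab (hp heq ▸ lt_irrefl _)
  · exact absurd hab (h b a hgt).asymm

theorem strictMono_vec5 {α : Type*} [Preorder α] {a b c d e : α} (hab : a < b) (hbc : b < c)
    (hcd : c < d) (hde : d < e) : StrictMono ![a, b, c, d, e] := by
  rw [Fin.strictMono_iff_lt_succ]
  intro i
  fin_cases i <;> assumption

section Patterns

variable {n : ℕ} {w : Equiv.Perm (Fin (n + 1))} {a b c d e : Fin (n + 1)}

theorem isOccSet_p45231 (hab : a < b) (hbc : b < c) (hcd : c < d) (hde : d < e)
    (h1 : w e < w c) (h2 : w c < w d) (h3 : w d < w a) (h4 : w a < w b) :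
    ∃ S : Finset ℕ, IsOccSet p45231 w S := by
  refine ⟨_, isOccSet_of_strictMono (strictMono_vec5 hab hbc hcd hde) (by decide) ?_⟩
  intro x y
  fin_cases x <;> fin_cases y <;> simp [p45231] <;> omega

theorem isOccSet_p45132 (hab : a < b) (hbc : b < c) (hcd : c < d) (hde : d < e)
    (h1 : w c < w e) (h2 : w e < w d) (h3 : w d < w a) (h4 : w a < w b) :
    ∃ S : Finset ℕ, IsOccSet p45132 w S := by
  refine ⟨_, isOccSet_of_strictMono (strictMono_vec5 hab hbc hcd hde) (by decide) ?_⟩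
  intro x y
  fin_cases x <;> fin_cases y <;> simp [p45132] <;> omega

theorem isTopOccSet_p43512 (hab : a < b) (hbc : b < c) (hcd : c < d) (hde : d < e)
    (h1 : w d < w e) (h2 : w e < w b) (h3 : w b < w a) (h4 : w a < w c)
    (htop : w c = Fin.last n) : ∃ S : Finset ℕ, IsTopOccSet p43512 w S := by
  refine ⟨_, isOccSet_of_strictMono (strictMono_vec5 hab hbc hcd hde) (by decide) ?_,
    Finset.mem_image.2 ⟨2, Finset.mem_univ _, by simp [htop]⟩⟩
  intro x y
  fin_cases x <;> fin_cases y <;> simp [p43512] <;> omega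

theorem isTopOccSet_p34512 (hab : a < b) (hbc : b < c) (hcd : c < d) (hde : d < e)
    (h1 : w d < w e) (h2 : w e < w a) (h3 : w a < w b) (h4 : w b < w c)
    (htop : w c = Fin.last n) : ∃ S : Finset ℕ, IsTopOccSet p34512 w S := by
  refine ⟨_, isOccSet_of_strictMono (strictMono_vec5 hab hbc hcd hde) (by decide) ?_,
    Finset.mem_image.2 ⟨2, Finset.mem_univ _, by simp [htop]⟩⟩
  intro x y
  fin_cases x <;> fin_cases y <;> simp [p34512] <;> omega

theorem isTopOccSet_p35412 (hab : a < b) (hbc : b < c) (hcd : c < d) (hde : d < e)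
    (h1 : w d < w e) (h2 : w e < w a) (h3 : w a < w c) (h4 : w c < w b)
    (htop : w b = Fin.last n) : ∃ S : Finset ℕ, IsTopOccSet p35412 w S := by
  refine ⟨_, isOccSet_of_strictMono (strictMono_vec5 hab hbc hcd hde) (by decide) ?_,
    Finset.mem_image.2 ⟨1, Finset.mem_univ _, by simp [htop]⟩⟩
  intro x y
  fin_cases x <;> fin_cases y <;> simp [p35412] <;> omega

end Patterns

/-- if `w` avoids 45231 and 45132, and some `N`-occurrence
`{a, N, b, c}` of 3412 in `w` has no `k ∈ newrep(w)` with `(a, c) = (M_k, m_k)`, then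
`w` has an `N`-occurrence of 43512, 34512, or 35412. -/
theorem occ3412_must_use_Mstat {n : ℕ} (w : Equiv.Perm (Fin (n + 1)))
    (wbar : Equiv.Perm (Fin n)) (hdel : IsDeletion w wbar)
    (hav1 : ¬ ∃ S : Finset ℕ, IsOccSet p45231 w S)
    (hav2 : ¬ ∃ S : Finset ℕ, IsOccSet p45132 w S)
    (i1 i2 i3 i4 : Fin (n + 1)) (h12 : i1 < i2) (h23 : i2 < i3) (h34 : i3 < i4)
    (htop : w i2 = Fin.last n)
    (ho1 : w i3 < w i4) (ho2 : w i4 < w i1) (ho3 : w i1 < w i2)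
    (hac : ¬ ∃ k ∈ newrep w wbar, (w i1 : ℕ) = Mstat wbar k ∧ (w i4 : ℕ) = mstat wbar k) :
    (∃ S : Finset ℕ, IsTopOccSet p43512 w S) ∨ (∃ S : Finset ℕ, IsTopOccSet p34512 w S) ∨
      (∃ S : Finset ℕ, IsTopOccSet p35412 w S) := by
  have lt_top : ∀ j, j ≠ i2 → w j < w i2 := fun j hj =>
    lt_of_le_of_ne (htop ▸ Fin.le_last _) (w.injective.ne hj)
  -- Move the third letter to the last position before `i4` holding a letter below `w i4`.
  obtain ⟨q, ⟨hq3, hq4, hqv⟩, hqmax⟩ :=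
    Set.exists_max_image {j : Fin (n + 1) | i3 ≤ j ∧ j < i4 ∧ w j < w i4} id
      (Set.toFinite _) ⟨i3, le_rfl, h34, ho1⟩
  simp only [Set.mem_ofPred_eq, id, and_imp] at hqmax
  have h2q : i2 < q := h23.trans_le hq3
  by_contra hno
  simp only [not_or] at hno
  obtain ⟨hn1, hn2, hn3⟩ := hno
  have hmax : ∀ j, j ≤ q → j ≠ i2 → w j ≤ w i1 := by
    intro j hjq hj2
    by_contra! hlt
    have hj1 : j ≠ i1 := by rintro rfl; exact lt_irrefl _ hlt
    have hjq' : j < q := lt_of_le_of_ne hjq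
      (by rintro rfl; exact absurd hlt (hqv.trans ho2).asymm)
    rcases lt_or_gt_of_ne hj2 with hj | hj
    · rcases lt_or_gt_of_ne hj1 with hj' | hj'
      · exact hn1 (isTopOccSet_p43512 hj' h12 h2q hq4 hqv ho2 hlt (lt_top j hj2) htop)
      · exact hn2 (isTopOccSet_p34512 hj' hj h2q hq4 hqv ho2 hlt (lt_top j hj2) htop)
    · exact hn3 (isTopOccSet_p35412 h12 hj hjq' hq4 hqv ho2 hlt (lt_top j hj2) htop)
  have hmin : ∀ j, q < j → w i4 ≤ w j := by
    intro j hqj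
    by_contra! hlt
    have hj4 : i4 < j := by
      refine lt_of_le_of_ne (not_lt.1 fun h => ?_) (by rintro rfl; exact lt_irrefl _ hlt)
      exact absurd hqj (hqmax j (hq3.trans hqj.le) h hlt).not_gt
    rcases lt_or_gt_of_ne (w.injective.ne hqj.ne) with h | h
    · exact hav2 (isOccSet_p45132 h12 h2q hq4 hj4 h hlt ho2 ho3)
    · exact hav1 (isOccSet_p45231 h12 h2q hq4 hj4 h hqv ho2 ho3)
  have hj1 : (i1 : ℕ) < n := by omega
  have hj4 : (i4 : ℕ) - 1 < n := by omega
  have e1 : (wbar ⟨i1, hj1⟩ : ℕ) = w i1 := by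
    obtain ⟨i, hi, hi'⟩ := hdel.exists_eq htop ⟨i1, hj1⟩
    obtain rfl : i = i1 := by ext; simp only at hi'; omega
    exact hi
  have e4 : (wbar ⟨i4 - 1, hj4⟩ : ℕ) = w i4 := by
    obtain ⟨i, hi, hi'⟩ := hdel.exists_eq htop ⟨i4 - 1, hj4⟩
    obtain rfl : i = i4 := by ext; simp only at hi'; omega
    exact hi
  refine hac ⟨(q : ℕ) - 1, ⟨?_, ?_⟩, ?_, ?_⟩
  · refine mem_supp_of_inversion (i := ⟨i1, hj1⟩) (j := ⟨i4 - 1, hj4⟩) ?_ ?_ ?_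
    · simp only; omega
    · simp only; omega
    · rw [Fin.lt_def, e1, e4]; exact ho2
  · rw [posOf_eq_of_apply_eq_last htop]; omega
  · rw [← e1]
    refine (Mstat_eq (by simp only; omega) fun j hj => ?_).symm
    obtain ⟨i, hi, hi'⟩ := hdel.exists_eq htop j
    rw [Fin.le_def, e1, hi]
    exact hmax i (by omega) (by omega)
  · rw [← e4]
    refine (mstat_eq (by simp only; omega) fun j hj => ?_).symm
    obtain ⟨i, hi, hi'⟩ := hdel.exists_eq htop j
    rw [Fin.le_def, e4, hi]
    exact hmin i (by omega)
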